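/- As s → 0 (s real, s ≠ 0), the function Φ₁(s) = Γ(s+1/2)·(1+5s)/(12·√π·s) satisfies lim_{s→0} (Φ₁(s) − 1/(12s)) = (5 − γ)/12 − (log 2)/6, where γ is the Euler–Mascheroni constant. In particular Φ₁ has a simple pole at s = 0 with residue 1/12. -/

import Mathlib

open Real Filter Topology

/-- The function `Φ₁(s) = Γ(s+1/2)·(1+5s)/(12√π·s)` satisfies
`lim_{s→0, s≠0} (Φ₁(s) − 1/(12s)) = (5−γ)/12 − (log 2)/6`, where `γ` is the
Euler–Mascheroni constant; in particular `Φ₁` has a simple pole at `s = 0`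
with residue `1/12`, i.e. `s·Φ₁(s) → 1/12` as `s → 0`. -/
theorem Phi_one_finite_part_at_zero :
    Tendsto (fun s : ℝ =>
        Real.Gamma (s + 1/2) * (1 + 5 * s) / (12 * Real.sqrt π * s) - 1 / (12 * s))
      (𝓝[≠] 0) (𝓝 ((5 - Real.eulerMascheroniConstant) / 12 - Real.log 2 / 6)) ∧
    Tendsto (fun s : ℝ =>
        s * (Real.Gamma (s + 1/2) * (1 + 5 * s) / (12 * Real.sqrt π * s)))
      (𝓝[≠] 0) (𝓝 (1 / 12)) := by
  set g : ℝ → ℝ := fun s => Real.Gamma (s + 1/2) * (1 + 5 * s) / (12 * Real.sqrt π) with hg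
  have hpi : Real.sqrt π ≠ 0 := (Real.sqrt_pos.mpr Real.pi_pos).ne'
  have hg0 : g 0 = 1 / 12 := by
    simp only [hg, zero_add, mul_zero, add_zero, mul_one, Real.Gamma_one_half_eq]
    field_simp
  have hGamma : HasDerivAt (fun s : ℝ => Real.Gamma (s + 1/2))
      (-√π * (Real.eulerMascheroniConstant + 2 * Real.log 2)) 0 := by
    have h := Real.hasDerivAt_Gamma_one_half
    rw [← zero_add (1 / 2 : ℝ)] at h
    exact h.comp_add_const 0 (1 / 2)
  have hlin : HasDerivAt (fun s : ℝ => 1 + 5 * s) 5 0 := by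
    simpa using ((hasDerivAt_id (0 : ℝ)).const_mul 5).const_add 1
  have hderiv : HasDerivAt g
      ((5 - Real.eulerMascheroniConstant) / 12 - Real.log 2 / 6) 0 := by
    refine ((hGamma.mul hlin).div_const (12 * Real.sqrt π)).congr_deriv ?_
    simp only [zero_add, mul_zero, add_zero, mul_one, Real.Gamma_one_half_eq]
    field_simp
    ring
  constructor
  · refine (hasDerivAt_iff_tendsto_slope.mp hderiv).congr' ?_
    filter_upwards [self_mem_nhdsWithin] with s hs
    have hs : s ≠ 0 := hs
    rw [slope_def_field, hg0]
    simp only [hg]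
    field_simp
    ring
  · have hcont : Tendsto g (𝓝[≠] 0) (𝓝 (1 / 12)) := by
      simpa only [hg0] using hderiv.continuousAt.tendsto.mono_left nhdsWithin_le_nhds
    refine hcont.congr' ?_
    filter_upwards [self_mem_nhdsWithin] with s hs
    have hs : s ≠ 0 := hs
    simp only [hg]
    field_simp
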